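/- For all nonzero integers r, s, t, there exists a sequence q : ℕ → ℚ such that (i) for every n, q n ≠ (r + t)/(r*s*t); (ii) the real sequence (q n : ℝ) tends to (r + t)/(r*s*t) as n → ∞; and (iii) for every n there exist nonzero integers a₁, a₂, a₃, a₄, a₅ such that, writing qₙ := (q n : ℝ) and M := A^{a₁} * (B qₙ)^{a₂} * A^{a₃} * (B qₙ)^{a₄} * A^{a₅} in SL(2,ℝ), one has qₙ * (M 0 1) - (M 1 0) = 0 (i.e. (a₁,a₂,a₃,a₄,a₅) is a length-5 half-relation for qₙ). That is, every 1-step relation number (r+t)/(rst) is an accumulation point of a non-constant sequence of rational length-5 half-relation numbers. -/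

import Mathlib

abbrev SL2R := Matrix.SpecialLinearGroup (Fin 2) ℝ

/-- The matrix `A = [[1,1],[0,1]]` in `SL(2,ℝ)`. -/
def A : SL2R := ⟨!![1,1;0,1], by norm_num [Matrix.det_fin_two_of]⟩

/-- The matrix `B q = [[1,0],[q,1]]` in `SL(2,ℝ)`. -/
def B (q : ℝ) : SL2R := ⟨!![1,0;q,1], by norm_num [Matrix.det_fin_two_of]⟩

open Filter Topology

theorem coe_A_zpow (n : ℤ) : ((A ^ n : SL2R) : Matrix (Fin 2) (Fin 2) ℝ) = !![1, (n : ℝ); 0, 1] := by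
  induction n using Int.induction_on with
  | zero => simp [Matrix.one_fin_two]
  | succ k ih =>
    rw [zpow_add_one, Matrix.SpecialLinearGroup.coe_mul, ih]
    simp [A, add_comm]
  | pred k ih =>
    rw [zpow_sub_one, Matrix.SpecialLinearGroup.coe_mul, ih,
      Matrix.SpecialLinearGroup.coe_inv]
    simp [A, Matrix.adjugate_fin_two, sub_eq_add_neg, add_comm]

theorem coe_B_zpow (q : ℝ) (n : ℤ) :
    ((B q ^ n : SL2R) : Matrix (Fin 2) (Fin 2) ℝ) = !![1, 0; n * q, 1] := by
  induction n using Int.induction_on with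
  | zero => simp [Matrix.one_fin_two]
  | succ k ih =>
    rw [zpow_add_one, Matrix.SpecialLinearGroup.coe_mul, ih]
    simp [B, add_mul]
  | pred k ih =>
    rw [zpow_sub_one, Matrix.SpecialLinearGroup.coe_mul, ih,
      Matrix.SpecialLinearGroup.coe_inv]
    simp [B, Matrix.adjugate_fin_two, sub_eq_add_neg, add_mul]

/-- The half-relation condition is `q` times a quadratic polynomial in `q`. -/
theorem half_relation_eq (q : ℝ) (a b c d e : ℤ) :
    q * ((A ^ a * (B q) ^ b * A ^ c * (B q) ^ d * A ^ e) 0 1)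
      - ((A ^ a * (B q) ^ b * A ^ c * (B q) ^ d * A ^ e) 1 0) =
    q * ((a + c + e - (b + d)) + q * (a * b * e + a * d * e + c * d * e + a * b * c - b * c * d)
      + a * b * c * d * e * q ^ 2) := by
  simp only [Matrix.SpecialLinearGroup.coe_mul, coe_A_zpow, coe_B_zpow]
  simp [Matrix.mul_apply, Fin.sum_univ_two]
  ring

theorem tendsto_const_div_natCast_add (k c : ℝ) :
    Tendsto (fun n : ℕ => k / ((n : ℝ) + c)) atTop (𝓝 0) :=
  tendsto_const_nhds.div_atTop
    (tendsto_atTop_add_const_right _ _ tendsto_natCast_atTop_atTop)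

/-- The case where the constant coefficient of the quadratic can be made to vanish. -/
theorem limit_of_half_relation_generic (r s t : ℤ) (hr : r ≠ 0) (hs : s ≠ 0) (ht : t ≠ 0)
    (h : ¬ (t = r ∧ s = -r)) :
    ∃ q : ℕ → ℚ,
      (∀ n, q n ≠ ((r : ℚ) + t) / (r * s * t)) ∧
      Tendsto (fun n => (q n : ℝ)) atTop (𝓝 (((r : ℝ) + t) / (r * s * t))) ∧
      (∀ n, ∃ a₁ a₂ a₃ a₄ a₅ : ℤ,
        a₁ ≠ 0 ∧ a₂ ≠ 0 ∧ a₃ ≠ 0 ∧ a₄ ≠ 0 ∧ a₅ ≠ 0 ∧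
        ((q n : ℝ) *
            ((A ^ a₁ * (B (q n : ℝ)) ^ a₂ * A ^ a₃ * (B (q n : ℝ)) ^ a₄ * A ^ a₅) 0 1)
          - ((A ^ a₁ * (B (q n : ℝ)) ^ a₂ * A ^ a₃ * (B (q n : ℝ)) ^ a₄ * A ^ a₅) 1 0) = 0)) := by
  obtain ⟨C, hC⟩ : ∃ C : ℤ, C = |r| + |s| + |t| + |r * (r + s)| + 1 := ⟨_, rfl⟩
  have hd (n : ℕ) : (n : ℤ) + C ≠ 0 := by
    have := abs_nonneg (r * (r + s))
    have := abs_nonneg r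
    have := abs_nonneg s
    have := abs_nonneg t
    omega
  have he (n : ℕ) : (n : ℤ) + C - (r + s + t) ≠ 0 := by
    have := abs_nonneg (r * (r + s))
    have := le_abs_self r
    have := le_abs_self s
    have := le_abs_self t
    omega
  have hrQ : (r : ℚ) ≠ 0 := by exact_mod_cast hr
  have hsQ : (s : ℚ) ≠ 0 := by exact_mod_cast hs
  have htQ : (t : ℚ) ≠ 0 := by exact_mod_cast ht
  have hrR : (r : ℝ) ≠ 0 := by exact_mod_cast hr
  have hsR : (s : ℝ) ≠ 0 := by exact_mod_cast hs
  have htR : (t : ℝ) ≠ 0 := by exact_mod_cast ht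
  refine ⟨fun n => ((r : ℚ) + t) / (r * s * t) - (t : ℚ)⁻¹ / (n + C) + (r : ℚ)⁻¹ / (n + (C - (r + s + t)))
    - 1 / (n + C) * (1 / (n + (C - (r + s + t)))), fun n hn => ?_, ?_, fun n => ?_⟩
  · have hdQ : (n : ℚ) + C ≠ 0 := by exact_mod_cast hd n
    have heQ : (n : ℚ) + (C - (r + s + t)) ≠ 0 := by
      rw [← add_sub_assoc]; exact_mod_cast he n
    have key : ((t : ℚ) - r) * (n + C) + r * (r + s) = 0 := by
      field_simp at hn
      have : (s : ℚ) * (((t : ℚ) - r) * (n + C) + r * (r + s)) = 0 := by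
        linear_combination hn
      simpa [hsQ] using this
    have key' : (t - r) * (n + C) + r * (r + s) = 0 := by exact_mod_cast key
    rcases eq_or_ne t r with htr | htr
    · refine h ⟨htr, ?_⟩
      rw [htr] at key'
      have : r + s = 0 := by simpa [hr] using key'
      omega
    · have h1 : 1 ≤ |t - r| := Int.one_le_abs (sub_ne_zero.2 htr)
      have h2 : |t - r| * |n + C| = |r * (r + s)| := by
        rw [← abs_mul, eq_neg_of_add_eq_zero_left key', abs_neg]
      have h3 : |(n : ℤ) + C| ≤ |r * (r + s)| := by
        rw [← h2]; exact le_mul_of_one_le_left (abs_nonneg _) h1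
      have := le_abs_self ((n : ℤ) + C)
      have := abs_nonneg r
      have := abs_nonneg s
      have := abs_nonneg t
      omega
  · push_cast
    have h1 := tendsto_const_div_natCast_add (t : ℝ)⁻¹ C
    have h2 := tendsto_const_div_natCast_add (r : ℝ)⁻¹ (C - (r + s + t))
    have h3 := tendsto_const_div_natCast_add 1 C
    have h4 := tendsto_const_div_natCast_add 1 ((C : ℝ) - (r + s + t))
    simpa using ((tendsto_const_nhds (x := ((r : ℝ) + t) / (r * s * t))).sub h1).add h2
      |>.sub (h3.mul h4)
  · refine ⟨r, -s, t, n + C, n + C - (r + s + t), hr, neg_ne_zero.2 hs, ht, hd n, he n, ?_⟩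
    have hdR : (n : ℝ) + C ≠ 0 := by exact_mod_cast hd n
    have heR : (n : ℝ) + (C - (r + s + t)) ≠ 0 := by
      rw [← add_sub_assoc]; exact_mod_cast he n
    rw [half_relation_eq]
    refine mul_eq_zero_of_right _ ?_
    push_cast
    field_simp
    ring

/-- The remaining case, where the limit is `-2 / r ^ 2`. -/
theorem limit_of_half_relation_special (r : ℤ) (hr : r ≠ 0) :
    ∃ q : ℕ → ℚ,
      (∀ n, q n ≠ -2 / (r : ℚ) ^ 2) ∧
      Tendsto (fun n => (q n : ℝ)) atTop (𝓝 (-2 / (r : ℝ) ^ 2)) ∧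
      (∀ n, ∃ a₁ a₂ a₃ a₄ a₅ : ℤ,
        a₁ ≠ 0 ∧ a₂ ≠ 0 ∧ a₃ ≠ 0 ∧ a₄ ≠ 0 ∧ a₅ ≠ 0 ∧
        ((q n : ℝ) *
            ((A ^ a₁ * (B (q n : ℝ)) ^ a₂ * A ^ a₃ * (B (q n : ℝ)) ^ a₄ * A ^ a₅) 0 1)
          - ((A ^ a₁ * (B (q n : ℝ)) ^ a₂ * A ^ a₃ * (B (q n : ℝ)) ^ a₄ * A ^ a₅) 1 0) = 0)) := by
  have hrQ : (r : ℚ) ≠ 0 := by exact_mod_cast hr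
  have hrR : (r : ℝ) ≠ 0 := by exact_mod_cast hr
  refine ⟨fun n => (-2 + 2⁻¹ / (n + 1)) / (r : ℚ) ^ 2, fun n hn => ?_, ?_, fun n => ?_⟩
  · have hn1 : (n : ℚ) + 1 ≠ 0 := by positivity
    field_simp at hn
    linarith
  · push_cast
    have h1 := tendsto_const_div_natCast_add (2 : ℝ)⁻¹ 1
    simpa using ((tendsto_const_nhds (x := (-2 : ℝ))).add h1).div_const ((r : ℝ) ^ 2)
  · refine ⟨r, r, r, -(r * (n + 1)), r * (2 * (2 * n + 1) * (n + 2)), hr, hr, hr,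
      neg_ne_zero.2 (mul_ne_zero hr (by positivity)), mul_ne_zero hr (by positivity), ?_⟩
    rw [half_relation_eq]
    refine mul_eq_zero_of_right _ ?_
    have hn1 : (n : ℝ) + 1 ≠ 0 := by positivity
    push_cast
    field_simp
    ring


/-- Every 1-step relation number `(r+t)/(rst)` is an accumulation point of a non-constant
sequence of rational length-5 half-relation numbers. -/
theorem one_step_limit_of_half_relation (r s t : ℤ) (hr : r ≠ 0) (hs : s ≠ 0) (ht : t ≠ 0) :
    ∃ q : ℕ → ℚ,
      (∀ n, q n ≠ ((r : ℚ) + t) / (r * s * t)) ∧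
      Filter.Tendsto (fun n => (q n : ℝ)) Filter.atTop
        (nhds (((r : ℝ) + t) / (r * s * t))) ∧
      (∀ n, ∃ a₁ a₂ a₃ a₄ a₅ : ℤ,
        a₁ ≠ 0 ∧ a₂ ≠ 0 ∧ a₃ ≠ 0 ∧ a₄ ≠ 0 ∧ a₅ ≠ 0 ∧
        ((q n : ℝ) *
            ((A ^ a₁ * (B (q n : ℝ)) ^ a₂ * A ^ a₃ * (B (q n : ℝ)) ^ a₄ * A ^ a₅) 0 1)
          - ((A ^ a₁ * (B (q n : ℝ)) ^ a₂ * A ^ a₃ * (B (q n : ℝ)) ^ a₄ * A ^ a₅) 1 0) = 0)) := by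
  by_cases h : t = r ∧ s = -r
  · obtain ⟨rfl, rfl⟩ := h
    have hQ : (t : ℚ) ≠ 0 := by exact_mod_cast hr
    have hR : (t : ℝ) ≠ 0 := by exact_mod_cast hr
    have eQ : ((t : ℚ) + t) / (t * (-t : ℤ) * t) = -2 / (t : ℚ) ^ 2 := by
      push_cast; field_simp; ring
    have eR : ((t : ℝ) + t) / (t * (-t : ℤ) * t) = -2 / (t : ℝ) ^ 2 := by
      push_cast; field_simp; ring
    rw [eQ, eR]
    exact limit_of_half_relation_special t hr
  · exact limit_of_half_relation_generic r s t hr hs ht h
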